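/- For any c ∈ ℭ_+ there exists N₀ such that c ∈ ℭ_+(N) for all N = (N_1,…,N_d) with min_j N_j ≥ N₀. -/

import Mathlib

open MeasureTheory Complex Set

noncomputable section

namespace RCE

/-- The scalar product (k,θ) = Σⱼ kⱼ θⱼ. -/
def dotP (d : ℕ) (k : Fin d → ℤ) (θ : Fin d → ℝ) : ℝ := ∑ j, (k j : ℝ) * θ j

/-- The d-dimensional torus 𝕋^d = (−π,π]^d. -/
def Td (d : ℕ) : Set (Fin d → ℝ) := Set.univ.pi fun _ => Set.Ioc (-Real.pi) Real.pi

/-- Normalized Lebesgue measure dm = (2π)^{-d} dθ on 𝕋^d. -/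
def dm (d : ℕ) : Measure (Fin d → ℝ) :=
  (ENNReal.ofReal ((2 * Real.pi) ^ d))⁻¹ • (volume.restrict (Td d))

/-- Conjugate-symmetric coefficient sequences supported on Λ. -/
def IsCoeff (d : ℕ) (Λ : Finset (Fin d → ℤ)) (p : (Fin d → ℤ) → ℂ) : Prop :=
  (∀ k, k ∉ Λ → p k = 0) ∧ ∀ k, p (-k) = starRingEnd ℂ (p k)

/-- Evaluation of the (real-valued) trigonometric polynomial
`P(e^{iθ}) = Σ_{k∈Λ} p_k e^{-i(k,θ)}`. -/
def eval (d : ℕ) (Λ : Finset (Fin d → ℤ)) (p : (Fin d → ℤ) → ℂ) (θ : Fin d → ℝ) : ℝ :=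
  (∑ k ∈ Λ, p k * Complex.exp (-(dotP d k θ : ℂ) * Complex.I)).re

/-- `𝔓̄₊` : the closed cone of nonnegative trigonometric polynomials. -/
def Pbar (d : ℕ) (Λ : Finset (Fin d → ℤ)) : Set ((Fin d → ℤ) → ℂ) :=
  {p | IsCoeff d Λ p ∧ ∀ θ ∈ Td d, 0 ≤ eval d Λ p θ}

/-- `𝔓₊` : the open cone of positive trigonometric polynomials. -/
def Pplus (d : ℕ) (Λ : Finset (Fin d → ℤ)) : Set ((Fin d → ℤ) → ℂ) :=
  {p | IsCoeff d Λ p ∧ ∀ θ ∈ Td d, 0 < eval d Λ p θ}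

/-- The pairing ⟨c,p⟩ = Σ_{k∈Λ} c_k conj(p_k) (real-valued by conjugate symmetry). -/
def pair (d : ℕ) (Λ : Finset (Fin d → ℤ)) (c p : (Fin d → ℤ) → ℂ) : ℝ :=
  (∑ k ∈ Λ, c k * starRingEnd ℂ (p k)).re

/-- `ℭ₊` : the interior of the dual cone. -/
def Cplus (d : ℕ) (Λ : Finset (Fin d → ℤ)) : Set ((Fin d → ℤ) → ℂ) :=
  {c | IsCoeff d Λ c ∧ ∀ p ∈ Pbar d Λ, p ≠ 0 → 0 < pair d Λ c p}

/-- `ℭ̄₊` : the closed dual cone. -/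
def Cbar (d : ℕ) (Λ : Finset (Fin d → ℤ)) : Set ((Fin d → ℤ) → ℂ) :=
  {c | IsCoeff d Λ c ∧ ∀ p ∈ Pbar d Λ, 0 ≤ pair d Λ c p}

/-- The dual functional J_P(Q) = ⟨c,q⟩ − ∫ P log Q dm. -/
def J (d : ℕ) (Λ : Finset (Fin d → ℤ)) (c P Q : (Fin d → ℤ) → ℂ) : ℝ :=
  pair d Λ c Q - ∫ θ, eval d Λ P θ * Real.log (eval d Λ Q θ) ∂(dm d)

/-- Covariance matching for an absolutely continuous measure Φ dm:
`c_k = ∫ e^{i(k,θ)} Φ(θ) dm(θ)` for all k ∈ Λ. -/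
def Matches (d : ℕ) (Λ : Finset (Fin d → ℤ)) (c : (Fin d → ℤ) → ℂ)
    (Φ : (Fin d → ℝ) → ℝ) : Prop :=
  ∀ k ∈ Λ, c k = ∫ θ, Complex.exp ((dotP d k θ : ℂ) * Complex.I) * (Φ θ : ℂ) ∂(dm d)

/-- The grid point θ_ℓ = (2π ℓ₁/N₁, …, 2π ℓ_d/N_d), so that ζ_ℓ = e^{iθ_ℓ}. -/
def gridθ (d : ℕ) (N : Fin d → ℕ) (L : (j : Fin d) → Fin (N j)) : Fin d → ℝ :=
  fun j => 2 * Real.pi * (L j : ℝ) / (N j : ℝ)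

/-- Evaluation of the trigonometric polynomial at the grid point ζ_ℓ. -/
def evalG (d : ℕ) (Λ : Finset (Fin d → ℤ)) (p : (Fin d → ℤ) → ℂ) (N : Fin d → ℕ)
    (L : (j : Fin d) → Fin (N j)) : ℝ :=
  eval d Λ p (gridθ d N L)

/-- `𝔓̄₊(N)` : polynomials nonnegative on the grid. -/
def PbarN (d : ℕ) (Λ : Finset (Fin d → ℤ)) (N : Fin d → ℕ) : Set ((Fin d → ℤ) → ℂ) :=
  {p | IsCoeff d Λ p ∧ ∀ L : (j : Fin d) → Fin (N j), 0 ≤ evalG d Λ p N L}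

/-- `𝔓₊(N)` : polynomials positive on the grid. -/
def PplusN (d : ℕ) (Λ : Finset (Fin d → ℤ)) (N : Fin d → ℕ) : Set ((Fin d → ℤ) → ℂ) :=
  {p | IsCoeff d Λ p ∧ ∀ L : (j : Fin d) → Fin (N j), 0 < evalG d Λ p N L}

/-- `ℭ₊(N)` : the interior of the dual cone of `𝔓̄₊(N)`. -/
def CplusN (d : ℕ) (Λ : Finset (Fin d → ℤ)) (N : Fin d → ℕ) : Set ((Fin d → ℤ) → ℂ) :=
  {c | IsCoeff d Λ c ∧ ∀ p ∈ PbarN d Λ N, p ≠ 0 → 0 < pair d Λ c p}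

/-- The discrete dual functional J_P^N(Q) = ⟨c,q⟩ − (Π_j N_j)⁻¹ Σ_ℓ P(ζ_ℓ) log Q(ζ_ℓ),
with the convention P(ζ_ℓ) log Q(ζ_ℓ) := 0 whenever P(ζ_ℓ) = 0. -/
def JN (d : ℕ) (Λ : Finset (Fin d → ℤ)) (N : Fin d → ℕ) (c P Q : (Fin d → ℤ) → ℂ) : ℝ :=
  pair d Λ c Q - (∏ j, (N j : ℝ))⁻¹ *
    ∑ L : (j : Fin d) → Fin (N j),
      (if evalG d Λ P N L = 0 then 0 else evalG d Λ P N L * Real.log (evalG d Λ Q N L))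

/-- The effective domain of J_P^N on `𝔓̄₊(N) \ {0}` : those Q for which the (extended-real
valued) functional J_P^N(Q) is finite, i.e. Q(ζ_ℓ) ≠ 0 whenever P(ζ_ℓ) ≠ 0.  Minimizing
J_P^N over `𝔓̄₊(N)` is the same as minimizing it over this set. -/
def domN (d : ℕ) (Λ : Finset (Fin d → ℤ)) (N : Fin d → ℕ) (P : (Fin d → ℤ) → ℂ) :
    Set ((Fin d → ℤ) → ℂ) :=
  {Q | Q ∈ PbarN d Λ N ∧ Q ≠ 0 ∧
    ∀ L : (j : Fin d) → Fin (N j), evalG d Λ P N L = 0 ∨ evalG d Λ Q N L ≠ 0}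

open Filter Topology

/-- Trigonometric polynomials are `2π`-periodic in every variable. -/
theorem eval_add_two_pi_mul_int (d : ℕ) (Λ : Finset (Fin d → ℤ)) (p : (Fin d → ℤ) → ℂ)
    (θ : Fin d → ℝ) (m : Fin d → ℤ) :
    eval d Λ p (fun j => θ j + 2 * Real.pi * (m j : ℝ)) = eval d Λ p θ := by
  unfold eval
  congr 1
  refine Finset.sum_congr rfl fun k _ => ?_
  congr 1
  refine Complex.exp_eq_exp_iff_exists_int.2 ⟨-∑ j, k j * m j, ?_⟩
  have h : dotP d k (fun j => θ j + 2 * Real.pi * (m j : ℝ))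
      = dotP d k θ + 2 * Real.pi * ∑ j, (k j : ℝ) * (m j : ℝ) := by
    simp only [dotP, Finset.mul_sum, ← Finset.sum_add_distrib]
    exact Finset.sum_congr rfl fun j _ => by ring
  rw [h]
  push_cast
  ring

theorem continuous_eval (d : ℕ) (Λ : Finset (Fin d → ℤ)) :
    Continuous fun x : ((Fin d → ℤ) → ℂ) × (Fin d → ℝ) => eval d Λ x.1 x.2 := by
  unfold eval dotP
  fun_prop

theorem continuous_pair (d : ℕ) (Λ : Finset (Fin d → ℤ)) (c : (Fin d → ℤ) → ℂ) :
    Continuous (pair d Λ c) := by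
  unfold pair
  fun_prop

theorem isClosed_setOf_isCoeff (d : ℕ) (Λ : Finset (Fin d → ℤ)) :
    IsClosed {p | IsCoeff d Λ p} := by
  have h : {p | IsCoeff d Λ p} = (⋂ k, ⋂ _ : k ∉ Λ, {p : (Fin d → ℤ) → ℂ | p k = 0}) ∩
      ⋂ k, {p : (Fin d → ℤ) → ℂ | p (-k) = starRingEnd ℂ (p k)} := by
    ext p
    simp [IsCoeff]
  rw [h]
  refine (isClosed_iInter fun k => isClosed_iInter fun _ => ?_).inter
    (isClosed_iInter fun k => ?_)
  · exact isClosed_eq (by fun_prop) (by fun_prop)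
  · exact isClosed_eq (by fun_prop) (by fun_prop)

/-- The unit sphere, for the `ℓ¹` norm, of the space of coefficient vectors is compact. -/
theorem isCompact_setOf_isCoeff_sum_norm_eq_one (d : ℕ) (Λ : Finset (Fin d → ℤ)) :
    IsCompact {p | IsCoeff d Λ p ∧ ∑ k ∈ Λ, ‖p k‖ = 1} := by
  refine (isCompact_univ_pi fun _ : Fin d → ℤ =>
    isCompact_closedBall (0 : ℂ) 1).of_isClosed_subset ?_ ?_
  · exact (isClosed_setOf_isCoeff d Λ).inter (isClosed_eq (by fun_prop) (by fun_prop))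
  · rintro p ⟨hp, hsum⟩ k -
    rw [mem_closedBall_zero_iff]
    by_cases hk : k ∈ Λ
    · exact (Finset.single_le_sum (f := fun k => ‖p k‖) (fun _ _ => norm_nonneg _) hk).trans_eq
        hsum
    · simp [hp.1 k hk]

theorem eval_smul (d : ℕ) (Λ : Finset (Fin d → ℤ)) (p : (Fin d → ℤ) → ℂ) (r : ℝ)
    (θ : Fin d → ℝ) : eval d Λ (fun k => (r : ℂ) * p k) θ = r * eval d Λ p θ := by
  simp only [eval, mul_assoc, ← Finset.mul_sum, Complex.re_ofReal_mul]

theorem pair_smul (d : ℕ) (Λ : Finset (Fin d → ℤ)) (c p : (Fin d → ℤ) → ℂ) (r : ℝ) :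
    pair d Λ c (fun k => (r : ℂ) * p k) = r * pair d Λ c p := by
  rw [pair, pair, ← Complex.re_ofReal_mul, Finset.mul_sum]
  simp only [map_mul, Complex.conj_ofReal, mul_left_comm]

/-- A nonzero polynomial can be rescaled to have `ℓ¹` norm one. -/
theorem exists_normalized_of_notMem_CplusN (d : ℕ) (Λ : Finset (Fin d → ℤ)) (N : Fin d → ℕ)
    (c : (Fin d → ℤ) → ℂ) (hc : IsCoeff d Λ c) (hN : c ∉ CplusN d Λ N) :
    ∃ p ∈ PbarN d Λ N, ∑ k ∈ Λ, ‖p k‖ = 1 ∧ pair d Λ c p ≤ 0 := by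
  obtain ⟨p, hp, hp0, hle⟩ : ∃ p ∈ PbarN d Λ N, p ≠ 0 ∧ pair d Λ c p ≤ 0 := by
    by_contra! h
    exact hN ⟨hc, h⟩
  obtain ⟨k, hk⟩ := Function.ne_iff.1 hp0
  have hkΛ : k ∈ Λ := by
    by_contra h
    exact hk (hp.1.1 k h)
  have hpos : 0 < ∑ k ∈ Λ, ‖p k‖ :=
    Finset.sum_pos' (fun _ _ => norm_nonneg _) ⟨k, hkΛ, norm_pos_iff.2 hk⟩
  set s := ∑ k ∈ Λ, ‖p k‖
  refine ⟨fun k => ((s⁻¹ : ℝ) : ℂ) * p k, ⟨⟨fun k hk => ?_, fun k => ?_⟩, fun L => ?_⟩, ?_, ?_⟩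
  · simp [hp.1.1 k hk]
  · simp [hp.1.2 k]
  · rw [evalG, eval_smul]
    exact mul_nonneg (inv_nonneg.2 hpos.le) (hp.2 L)
  · simp only [norm_mul, Complex.norm_real, Real.norm_of_nonneg (inv_nonneg.2 hpos.le),
      ← Finset.mul_sum]
    exact inv_mul_cancel₀ hpos.ne'
  · rw [pair_smul]
    exact mul_nonpos_of_nonneg_of_nonpos (inv_nonneg.2 hpos.le) hle

/-- Every point of `[0, 2π)^d` is a limit of grid points as the mesh tends to zero. -/
theorem exists_tendsto_gridθ (d : ℕ) (M : ℕ → Fin d → ℕ)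
    (hM0 : ∀ n j, 0 < M n j) (hM : ∀ j, Tendsto (fun n => M n j) atTop atTop)
    (x : Fin d → ℝ) (hx0 : ∀ j, 0 ≤ x j) (hx1 : ∀ j, x j < 1) :
    ∃ L : (n : ℕ) → (j : Fin d) → Fin (M n j),
      Tendsto (fun n => gridθ d (M n) (L n)) atTop (𝓝 fun j => 2 * Real.pi * x j) := by
  refine ⟨fun n j => ⟨⌊x j * M n j⌋₊, ?_⟩, tendsto_pi_nhds.2 fun j => ?_⟩
  · rw [Nat.floor_lt (mul_nonneg (hx0 j) (Nat.cast_nonneg _))]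
    exact mul_lt_of_lt_one_left (Nat.cast_pos.2 (hM0 n j)) (hx1 j)
  · have h := ((tendsto_nat_floor_mul_div_atTop (hx0 j)).comp
      (tendsto_natCast_atTop_atTop.comp (hM j))).const_mul (2 * Real.pi)
    exact h.congr fun n => by simp [gridθ, mul_div_assoc]

/-- A limit of polynomials that are nonnegative on finer and finer grids is nonnegative. -/
theorem eval_nonneg_of_tendsto (d : ℕ) (Λ : Finset (Fin d → ℤ)) (M : ℕ → Fin d → ℕ)
    (hM0 : ∀ n j, 0 < M n j) (hM : ∀ j, Tendsto (fun n => M n j) atTop atTop)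
    (p : ℕ → (Fin d → ℤ) → ℂ) (hp : ∀ n, p n ∈ PbarN d Λ (M n)) (q : (Fin d → ℤ) → ℂ)
    (hpq : Tendsto p atTop (𝓝 q)) (θ : Fin d → ℝ) : 0 ≤ eval d Λ q θ := by
  obtain ⟨L, hL⟩ := exists_tendsto_gridθ d M hM0 hM (fun j => Int.fract (θ j / (2 * Real.pi)))
    (fun j => Int.fract_nonneg _) (fun j => Int.fract_lt_one _)
  have hθ : (fun j => 2 * Real.pi * Int.fract (θ j / (2 * Real.pi))
      + 2 * Real.pi * (⌊θ j / (2 * Real.pi)⌋ : ℝ)) = θ := by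
    funext j
    rw [← mul_add, Int.fract_add_floor, mul_div_cancel₀ _ Real.two_pi_pos.ne']
  rw [← hθ, eval_add_two_pi_mul_int]
  exact ge_of_tendsto' (((continuous_eval d Λ).tendsto _).comp (hpq.prodMk_nhds hL))
    fun n => (hp n).2 (L n)

/-- for any c ∈ ℭ₊ there exists N₀ such that c ∈ ℭ₊(N) for all
N = (N₁,…,N_d) with minⱼ Nⱼ ≥ N₀. -/
theorem statement18 (d : ℕ) (hd : 1 ≤ d) (Λ : Finset (Fin d → ℤ))
    (h0 : (0 : Fin d → ℤ) ∈ Λ) (hΛ : ∀ k ∈ Λ, -k ∈ Λ)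
    (c : (Fin d → ℤ) → ℂ) (hc : c ∈ Cplus d Λ) :
    ∃ N₀ : ℕ, ∀ N : Fin d → ℕ, (∀ j, N₀ ≤ N j) → c ∈ CplusN d Λ N := by
  by_contra! h
  choose M hM hcM using fun n : ℕ => h (n + 1)
  choose p hp hp1 hcp using fun n => exists_normalized_of_notMem_CplusN d Λ (M n) c hc.1 (hcM n)
  obtain ⟨q, ⟨hq, hq1⟩, φ, hφ, hpq⟩ := (isCompact_setOf_isCoeff_sum_norm_eq_one d Λ).tendsto_subseq
    fun n => ⟨(hp n).1, hp1 n⟩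
  have hMφ : ∀ j, Tendsto (fun n => M (φ n) j) atTop atTop := fun j =>
    tendsto_atTop_mono (fun n => (Nat.le_succ n).trans (hM n j)) tendsto_id |>.comp
      hφ.tendsto_atTop
  have hqP : q ∈ Pbar d Λ := ⟨hq, fun θ _ => eval_nonneg_of_tendsto d Λ (fun n => M (φ n))
    (fun n j => (Nat.succ_pos _).trans_le (hM (φ n) j)) hMφ _ (fun n => hp (φ n)) q hpq θ⟩
  have hq0 : q ≠ 0 := by
    rintro rfl
    simp at hq1
  exact (hc.2 q hqP hq0).not_ge (le_of_tendsto' (((continuous_pair d Λ c).tendsto q).comp hpq)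
    fun n => hcp (φ n))

end RCE
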